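/- Let A be a left brace such that A^{(n)} = 0 for some n. If the adjoint group A° of A is a nilpotent group, then Aᵐ = 0 for some m, and hence A^{[s]} = 0 for some s. -/

import Mathlib

namespace Paper

/-- A left brace: an abelian group `(A,+)` with a multiplication `bmul` that is left
distributive over addition and such that the circle operation
`a ∘ b = a·b + a + b` makes `A` into a group (the adjoint group) with identity `0`. -/
class LeftBrace (A : Type*) extends AddCommGroup A where
  bmul : A → A → A
  bmul_add : ∀ a b c : A, bmul a (b + c) = bmul a b + bmul a c
  circ_assoc : ∀ a b c : A,
    bmul (bmul a b + a + b) c + (bmul a b + a + b) + c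
      = bmul a (bmul b c + b + c) + a + (bmul b c + b + c)
  zero_circ : ∀ a : A, bmul 0 a + 0 + a = a
  circ_zero : ∀ a : A, bmul a 0 + a + 0 = a
  exists_circ_inv : ∀ a : A, ∃ b : A, bmul a b + a + b = 0 ∧ bmul b a + b + a = 0

namespace LeftBrace

variable {A : Type*} [LeftBrace A]

/-- The circle operation `a ∘ b = a·b + a + b` of a left brace. -/
def circ (a b : A) : A := bmul a b + a + b

/-- The adjoint group `A°` of a left brace: the group `(A, ∘)`. -/
noncomputable def adjointGroup (A : Type*) [LeftBrace A] : Group A where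
  mul := circ
  one := (0 : A)
  inv a := Classical.choose (exists_circ_inv a)
  mul_assoc := circ_assoc
  one_mul := zero_circ
  mul_one := circ_zero
  inv_mul_cancel a := (Classical.choose_spec (exists_circ_inv a)).2

/-- The adjoint group `A°` of the left brace `A` is a nilpotent group. -/
def AdjointNilpotent (A : Type*) [LeftBrace A] : Prop :=
  @Group.IsNilpotent A (adjointGroup A)

/-- For subsets `C, D ⊆ A`, `C · D` is the set of all finite sums `Σ cᵢ·dᵢ`
with `cᵢ ∈ C`, `dᵢ ∈ D`, i.e. the additive submonoid generated by the products. -/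
def setMulSub (C D : Set A) : AddSubmonoid A :=
  AddSubmonoid.closure {x : A | ∃ c ∈ C, ∃ d ∈ D, x = bmul c d}

/-- `C · D` as a set. -/
def setMul (C D : Set A) : Set A := (setMulSub C D : Set A)

/-- `pow A n = Aⁿ` for `n ≥ 1`: `A¹ = A`, `A^{n+1} = A · Aⁿ`.  (`pow A 0` is set to `A`.) -/
def pow (A : Type*) [LeftBrace A] : ℕ → Set A
  | 0 => Set.univ
  | 1 => Set.univ
  | (n+2) => setMul Set.univ (pow A (n+1))

/-- `rpow A n = A^{(n)}` for `n ≥ 1`: `A^{(1)} = A`, `A^{(n+1)} = A^{(n)} · A`.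
(`rpow A 0` is set to `A`.) -/
def rpow (A : Type*) [LeftBrace A] : ℕ → Set A
  | 0 => Set.univ
  | 1 => Set.univ
  | (n+2) => setMul (rpow A (n+1)) Set.univ

/-- `brk A n = A^{[n]}` for `n ≥ 1`: `A^{[1]} = A`,
`A^{[n+1]} = Σ_{i=1}^{n} A^{[i]} · A^{[n+1-i]}`.  (`brk A 0` is set to `A`.) -/
def brk (A : Type*) [LeftBrace A] : ℕ → Set A
  | 0 => Set.univ
  | 1 => Set.univ
  | (n+2) =>
    (((Finset.range (n+1)).attach.sup
      (fun i => setMulSub (brk A (i.1 + 1)) (brk A (n + 1 - i.1)))) : AddSubmonoid A)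
  decreasing_by
  · have h := i.2; simp only [Finset.mem_range] at h; omega
  · omega


/-- The product of a family of left braces, with componentwise operations. -/
noncomputable def piBrace {ι : Type*} (B : ι → Type*) (instB : ∀ i, LeftBrace (B i)) :
    LeftBrace (∀ i, B i) :=
  letI : ∀ i, LeftBrace (B i) := instB
  { (inferInstance : AddCommGroup (∀ i, B i)) with
    bmul := fun f g i => bmul (f i) (g i)
    bmul_add := fun a b c => funext fun i => bmul_add (a i) (b i) (c i)
    circ_assoc := fun a b c => funext fun i => circ_assoc (a i) (b i) (c i)
    zero_circ := fun a => funext fun i => zero_circ (a i)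
    circ_zero := fun a => funext fun i => circ_zero (a i)
    exists_circ_inv := fun a =>
      ⟨fun i => Classical.choose (exists_circ_inv (a i)),
        funext fun i => (Classical.choose_spec (exists_circ_inv (a i))).1,
        funext fun i => (Classical.choose_spec (exists_circ_inv (a i))).2⟩ }

/-- An isomorphism of left braces: an additive isomorphism preserving the brace
multiplication. -/
structure BraceIso (A B : Type*) [LeftBrace A] [LeftBrace B] extends A ≃+ B where
  map_bmul : ∀ a b : A, toAddEquiv (bmul a b) = bmul (toAddEquiv a) (toAddEquiv b)

/-- `A` is the direct sum of (finitely many) left braces whose cardinalities are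
powers of prime numbers. -/
def IsPrimePowerDirectSum (A : Type*) [LeftBrace A] : Prop :=
  ∃ (k : ℕ) (B : Fin k → Type) (instB : ∀ i, LeftBrace (B i)),
    (∀ i, ∃ p m : ℕ, p.Prime ∧ Nat.card (B i) = p ^ m) ∧
    Nonempty (@BraceIso A (∀ i, B i) _ (piBrace B instB))

section AdjointGroup

attribute [local instance] adjointGroup

theorem adjoint_mul_def (a b : A) : a * b = bmul a b + a + b := rfl

theorem adjoint_one_def : (1 : A) = 0 := rfl

theorem bmul_zero_right (a : A) : bmul a 0 = 0 := by
  simpa using bmul_add a 0 0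

theorem bmul_neg_right (a b : A) : bmul a (-b) = -bmul a b := by
  rw [eq_neg_iff_add_eq_zero, ← bmul_add, neg_add_cancel, bmul_zero_right]

theorem bmul_adjoint_mul (a b c : A) :
    bmul (a * b) c = bmul a (bmul b c) + bmul a c + bmul b c := by
  have h := circ_assoc a b c
  rw [bmul_add, bmul_add] at h
  rw [adjoint_mul_def]
  linear_combination (norm := abel) h

/-- An ideal of a left brace, as an additive subgroup absorbing products on both sides. -/
structure IsIdeal (I : AddSubgroup A) : Prop where
  bmul_mem_left : ∀ b, ∀ x ∈ I, bmul b x ∈ I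
  bmul_mem_right : ∀ x ∈ I, ∀ b, bmul x b ∈ I

theorem adjoint_conj_eq (b x : A) :
    b * x * b⁻¹ = bmul b (bmul x b⁻¹) + bmul x b⁻¹ + (bmul b x + x) := by
  have h : bmul b b⁻¹ + b + b⁻¹ = 0 := mul_inv_cancel b
  rw [adjoint_mul_def (b * x), bmul_adjoint_mul, adjoint_mul_def b x]
  linear_combination (norm := abel) h

theorem IsIdeal.conj_mem {I : AddSubgroup A} (hI : IsIdeal I) (b : A) {x : A} (hx : x ∈ I) :
    b * x * b⁻¹ ∈ I := by
  rw [adjoint_conj_eq]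
  have h := hI.bmul_mem_right x hx b⁻¹
  exact add_mem (add_mem (hI.bmul_mem_left b _ h) h) (add_mem (hI.bmul_mem_left b x hx) hx)

theorem IsIdeal.adjoint_mul_mem {I : AddSubgroup A} (hI : IsIdeal I) {x y : A}
    (hx : x ∈ I) (hy : y ∈ I) : x * y ∈ I :=
  add_mem (add_mem (hI.bmul_mem_left x y hy) hx) hy

theorem adjoint_inv_eq (x : A) : x⁻¹ = -(bmul x⁻¹ x + x) := by
  have h : bmul x⁻¹ x + x⁻¹ + x = 0 := inv_mul_cancel x
  rw [eq_neg_iff_add_eq_zero, ← h]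
  abel

theorem IsIdeal.adjoint_inv_mem {I : AddSubgroup A} (hI : IsIdeal I) {x : A}
    (hx : x ∈ I) : x⁻¹ ∈ I := by
  rw [adjoint_inv_eq]
  exact neg_mem (add_mem (hI.bmul_mem_left _ x hx) hx)

/-- The additive subgroup `I · A`. -/
def mulTop (I : AddSubgroup A) : AddSubgroup A :=
  AddSubgroup.closure {x : A | ∃ c ∈ I, ∃ d, x = bmul c d}

theorem bmul_mem_mulTop {I : AddSubgroup A} {x : A} (hx : x ∈ I) (b : A) :
    bmul x b ∈ mulTop I :=
  AddSubgroup.subset_closure ⟨x, hx, b, rfl⟩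

theorem IsIdeal.mulTop_le {I : AddSubgroup A} (hI : IsIdeal I) : mulTop I ≤ I := by
  rw [mulTop, AddSubgroup.closure_le]
  rintro _ ⟨c, hc, d, rfl⟩
  exact hI.bmul_mem_right c hc d

theorem bmul_bmul_eq (b x a : A) :
    bmul b (bmul x a) = bmul (b * x * b⁻¹) (bmul b a + a) - bmul x a := by
  have h : b * x * b⁻¹ * b = b * x := by group
  have h1 := bmul_adjoint_mul (b * x * b⁻¹) b a
  rw [h, bmul_adjoint_mul] at h1
  rw [bmul_add]
  linear_combination (norm := abel) h1

theorem IsIdeal.mulTop {I : AddSubgroup A} (hI : IsIdeal I) : IsIdeal (mulTop I) where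
  bmul_mem_left b x hx := by
    induction hx using AddSubgroup.closure_induction with
    | mem x hx =>
      obtain ⟨c, hc, d, rfl⟩ := hx
      rw [bmul_bmul_eq]
      exact sub_mem (bmul_mem_mulTop (hI.conj_mem b hc) _) (bmul_mem_mulTop hc d)
    | zero => rw [bmul_zero_right]; exact zero_mem _
    | add x y _ _ hx hy => rw [bmul_add]; exact add_mem hx hy
    | neg x _ hx => rw [bmul_neg_right]; exact neg_mem hx
  bmul_mem_right x hx b := bmul_mem_mulTop (hI.mulTop_le hx) b

/-- For an ideal `I`, products `b · g` with `g ∈ I` agree with group commutators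
modulo `I · A`. -/
theorem IsIdeal.bmul_sub_commutator_mem {I : AddSubgroup A} (hI : IsIdeal I) (b : A) {g : A}
    (hg : g ∈ I) : bmul b g - b * g * b⁻¹ * g⁻¹ ∈ LeftBrace.mulTop I := by
  have hu : b * g * b⁻¹ * g⁻¹ ∈ I :=
    hI.adjoint_mul_mem (hI.conj_mem b hg) (hI.adjoint_inv_mem hg)
  set u := b * g * b⁻¹ * g⁻¹ with hu_def
  have h : u * (g * b) = b * g := by rw [hu_def]; group
  have h1 : bmul b g - u = bmul u (g * b) + bmul g b := by
    rw [adjoint_mul_def u, adjoint_mul_def b] at h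
    have h2 := adjoint_mul_def g b
    linear_combination (norm := abel) h2 - h
  rw [h1]
  exact add_mem (bmul_mem_mulTop hu _) (bmul_mem_mulTop hg _)

/-- The elements of `I` congruent modulo `I · A` to an element of the subgroup `H` of the
adjoint group. -/
def congruentTo {I : AddSubgroup A} (hI : IsIdeal I) (H : Subgroup A) : AddSubmonoid A where
  carrier := {x | ∃ g ∈ H, g ∈ I ∧ x - g ∈ mulTop I}
  zero_mem' := ⟨0, H.one_mem, I.zero_mem, by simp⟩
  add_mem' := by
    rintro x y ⟨g, hgH, hg, hx⟩ ⟨k, hkH, hk, hy⟩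
    refine ⟨g * k, H.mul_mem hgH hkH, hI.adjoint_mul_mem hg hk, ?_⟩
    have h : x + y - g * k = (x - g) + (y - k) - bmul g k := by
      rw [adjoint_mul_def]; abel
    rw [h]
    exact sub_mem (add_mem hx hy) (bmul_mem_mulTop hg k)

theorem bmul_mem_congruentTo {I : AddSubgroup A} (hI : IsIdeal I) (i : ℕ) (b : A) {x : A}
    (hx : x ∈ congruentTo hI (Subgroup.lowerCentralSeries (⊤ : Subgroup A) i)) :
    bmul b x ∈ congruentTo hI (Subgroup.lowerCentralSeries (⊤ : Subgroup A) (i + 1)) := by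
  obtain ⟨g, hgH, hg, hxg⟩ := hx
  refine ⟨b * g * b⁻¹ * g⁻¹, ?_, ?_, ?_⟩
  · have h := Subgroup.commutator_mem_commutator hgH (Subgroup.mem_top b)
    have h2 := inv_mem h
    rw [commutatorElement_inv] at h2
    exact h2
  · exact hI.adjoint_mul_mem (hI.conj_mem b hg) (hI.adjoint_inv_mem hg)
  · have h : bmul b x = bmul b (x - g) + bmul b g := by rw [← bmul_add, sub_add_cancel]
    rw [h, add_sub_assoc]
    exact add_mem (hI.mulTop.bmul_mem_left b _ hxg) (hI.bmul_sub_commutator_mem b hg)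

theorem setMulSub_le {C D : Set A} {M : AddSubmonoid A}
    (h : ∀ c ∈ C, ∀ d ∈ D, bmul c d ∈ M) : setMulSub C D ≤ M := by
  rw [setMulSub, AddSubmonoid.closure_le]
  rintro _ ⟨c, hc, d, hd, rfl⟩
  exact h c hc d hd

/-- The left power `A^{m+1}` as an additive submonoid. -/
def leftPow (A : Type*) [LeftBrace A] : ℕ → AddSubmonoid A
  | 0 => ⊤
  | m + 1 => setMulSub Set.univ (leftPow A m)

theorem coe_leftPow (m : ℕ) : (leftPow A m : Set A) = pow A (m + 1) := by
  induction m with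
  | zero => rfl
  | succ m ih => rw [leftPow, ih]; rfl

theorem bmul_mem_leftPow (b : A) {m : ℕ} {x : A} (hx : x ∈ leftPow A m) :
    bmul b x ∈ leftPow A (m + 1) :=
  AddSubmonoid.subset_closure ⟨b, Set.mem_univ b, x, hx, rfl⟩

/-- The right power `A^{(k+1)}` as an additive subgroup. -/
def rightPow (A : Type*) [LeftBrace A] : ℕ → AddSubgroup A
  | 0 => ⊤
  | k + 1 => mulTop (rightPow A k)

theorem coe_rightPow (k : ℕ) : (rightPow A k : Set A) = rpow A (k + 1) := by
  induction k with
  | zero => rfl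
  | succ k ih =>
    have h : (mulTop (rightPow A k)).toAddSubmonoid =
        setMulSub (rightPow A k : Set A) Set.univ := by
      apply le_antisymm
      · rw [mulTop, AddSubgroup.closure_toAddSubmonoid, AddSubmonoid.closure_le]
        rintro x (⟨c, hc, d, rfl⟩ | ⟨c, hc, d, hx⟩)
        · exact AddSubmonoid.subset_closure ⟨c, hc, d, Set.mem_univ d, rfl⟩
        · refine AddSubmonoid.subset_closure ⟨c, hc, -d, Set.mem_univ _, ?_⟩
          rw [bmul_neg_right, ← hx, neg_neg]
      · exact setMulSub_le fun c hc d _ => bmul_mem_mulTop hc d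
    change ((mulTop (rightPow A k)).toAddSubmonoid : Set A) = _
    rw [h, ih]
    rfl

theorem isIdeal_rightPow (k : ℕ) : IsIdeal (rightPow A k) := by
  induction k with
  | zero => exact ⟨fun _ _ _ => AddSubgroup.mem_top _, fun _ _ _ => AddSubgroup.mem_top _⟩
  | succ k ih => exact ih.mulTop

theorem exists_leftPow_le_mulTop (hnil : AdjointNilpotent A) {I : AddSubgroup A}
    (hI : IsIdeal I) {m : ℕ} (hm : leftPow A m ≤ I.toAddSubmonoid) :
    ∃ m', leftPow A m' ≤ (mulTop I).toAddSubmonoid := by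
  obtain ⟨c, hc⟩ := (Subgroup.nilpotent_iff_lowerCentralSeries (G := A)).1 hnil
  have key : ∀ i, leftPow A (m + i) ≤
      congruentTo hI (Subgroup.lowerCentralSeries (⊤ : Subgroup A) i) := by
    intro i
    induction i with
    | zero =>
      intro x hx
      exact ⟨x, by simp, hm hx, by simp⟩
    | succ i ih =>
      exact setMulSub_le fun b _ x hx => bmul_mem_congruentTo hI i b (ih hx)
  refine ⟨m + c, fun x hx => ?_⟩
  obtain ⟨g, hg, -, hxg⟩ := key c hx
  rw [hc, Subgroup.mem_bot, adjoint_one_def] at hg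
  simpa [hg] using hxg

theorem exists_leftPow_le_rightPow (hnil : AdjointNilpotent A) (k : ℕ) :
    ∃ m, leftPow A m ≤ (rightPow A k).toAddSubmonoid := by
  induction k with
  | zero => exact ⟨0, fun _ _ => AddSubgroup.mem_top _⟩
  | succ k ih =>
    obtain ⟨m, hm⟩ := ih
    exact exists_leftPow_le_mulTop hnil (isIdeal_rightPow k) hm

theorem brk_subset {t : ℕ} {M : AddSubmonoid A}
    (h : ∀ i ≤ t, ∀ a ∈ brk A (i + 1), ∀ b ∈ brk A (t + 1 - i), bmul a b ∈ M) :
    brk A (t + 2) ⊆ M := by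
  rw [brk, SetLike.coe_subset_coe]
  refine Finset.sup_le fun i _ => setMulSub_le (h i.1 ?_)
  have := Finset.mem_range.1 i.2
  omega

theorem zero_mem_brk (t : ℕ) : (0 : A) ∈ brk A t := by
  match t with
  | 0 => rw [brk]; exact Set.mem_univ _
  | 1 => rw [brk]; exact Set.mem_univ _
  | t + 2 => rw [brk]; exact zero_mem _

/-- If all sufficiently long bracket powers lie in an ideal `I`, then longer ones lie in the sum of
`I · A` and any prescribed left power. -/
theorem brk_subset_mulTop_sup_leftPow {I : AddSubgroup A} (hI : IsIdeal I) {s : ℕ}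
    (hs : ∀ t, s ≤ t → brk A t ⊆ I) (j t : ℕ) (ht : j * s + 2 ≤ t) :
    brk A t ⊆ ((mulTop I).toAddSubmonoid ⊔ leftPow A j : AddSubmonoid A) := by
  induction j generalizing t with
  | zero =>
    intro x _
    exact AddSubmonoid.mem_sup_right (AddSubmonoid.mem_top x)
  | succ j ih =>
    obtain ⟨t, rfl⟩ : ∃ r, t = r + 2 := ⟨t - 2, by omega⟩
    refine brk_subset fun i hi a ha b hb => ?_
    rcases le_or_gt s (i + 1) with h | h
    · exact AddSubmonoid.mem_sup_left (bmul_mem_mulTop (hs _ h ha) b)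
    · have hb' := ih (t + 1 - i) (by rw [add_mul] at ht; omega) hb
      obtain ⟨y, hy, z, hz, rfl⟩ := AddSubmonoid.mem_sup.1 hb'
      rw [bmul_add]
      exact add_mem (AddSubmonoid.mem_sup_left (hI.mulTop.bmul_mem_left a y hy))
        (AddSubmonoid.mem_sup_right (bmul_mem_leftPow a hz))

theorem exists_brk_subset_rightPow {m : ℕ} (hm : leftPow A m = ⊥) (k : ℕ) :
    ∃ s, ∀ t, s ≤ t → brk A t ⊆ rightPow A k := by
  induction k with
  | zero => exact ⟨0, fun _ _ _ _ => AddSubgroup.mem_top _⟩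
  | succ k ih =>
    obtain ⟨s, hs⟩ := ih
    refine ⟨m * s + 2, fun t ht => ?_⟩
    have h := brk_subset_mulTop_sup_leftPow (isIdeal_rightPow k) hs m t ht
    rw [hm, sup_bot_eq] at h
    exact h

end AdjointGroup

/-- Let `A` be a left brace with `A^{(n)} = 0` for some `n`. If the
adjoint group `A°` is nilpotent, then `Aᵐ = 0` for some `m`, and hence `A^{[s]} = 0`
for some `s`. -/
theorem leftBrace_pow_eq_bot_of_rpow_and_nilpotent
    (A : Type) [LeftBrace A] (n : ℕ) (hn : 1 ≤ n) (h : rpow A n = {0})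
    (hnil : AdjointNilpotent A) :
    (∃ m : ℕ, 1 ≤ m ∧ pow A m = {0}) ∧ (∃ s : ℕ, 1 ≤ s ∧ brk A s = {0}) := by
  obtain ⟨k, rfl⟩ : ∃ k, n = k + 1 := ⟨n - 1, by omega⟩
  rw [← coe_rightPow] at h
  obtain ⟨m, hm⟩ := exists_leftPow_le_rightPow hnil k
  have hbot : leftPow A m = ⊥ := by
    refine (AddSubmonoid.eq_bot_iff_forall _).2 fun x hx => ?_
    have hx' : x ∈ (rightPow A k : Set A) := hm hx
    rwa [h] at hx'
  refine ⟨⟨m + 1, by omega, ?_⟩, ?_⟩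
  · rw [← coe_leftPow, hbot, AddSubmonoid.coe_bot]
  · obtain ⟨s, hs⟩ := exists_brk_subset_rightPow hbot k
    refine ⟨s + 1, by omega, Set.Subset.antisymm ?_ ?_⟩
    · exact (hs (s + 1) (by omega)).trans h.subset
    · exact Set.singleton_subset_iff.2 (zero_mem_brk _)

end LeftBrace

end Paper
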